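/- Let p ≥ 1, N ≥ 1, and let λ : ℝᵖ × ℝ → ℝ be such that for each u ≥ 0 the map θ ↦ λ(θ, u) is differentiable with ‖∇_θ λ(θ, u)‖ ≤ L for all θ and all u ≥ 0, and λ(θ, u) ≥ λ_min > 0 for all θ, u ≥ 0; assume θ ↦ ∫₀^τ λ(θ,u) du is differentiable with gradient ∫₀^τ ∇_θ λ(θ,u) du for every τ ≥ 0. Define Λ(θ, τ) = ∫₀^τ λ(θ, u) du, fix inter-arrival times τ_1, …, τ_N ≥ 0 and ΔT ≥ 0 with τ_1 + ⋯ + τ_N + ΔT = T, and define the loss 𝓛(θ) = ∑_{i=1}^N Λ(θ, τ_i) + Λ(θ, ΔT) − ∑_{i=1}^N log λ(θ, τ_i). Then 𝓛 is differentiable in θ and ‖∇_θ 𝓛(θ)‖ ≤ L·(T + N/λ_min). In particular, if T = N/λ̄ for an average rate λ̄ > 0, then ‖∇_θ 𝓛(θ)‖ ≤ L·N·(1/λ̄ + 1/λ_min): the gradient norm grows at most linearly in the number of events N. -/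

import Mathlib

open Set Filter MeasureTheory

/-- A function bounded in norm by `C` on `[0, ∞)` has integral over `[0, τ]` bounded by `C * τ`. -/
theorem norm_intervalIntegral_le_mul {E : Type*} [NormedAddCommGroup E] [NormedSpace ℝ E]
    {f : ℝ → E} {C τ : ℝ} (hτ : 0 ≤ τ) (hf : ∀ u ≥ (0:ℝ), ‖f u‖ ≤ C) :
    ‖∫ u in (0:ℝ)..τ, f u‖ ≤ C * τ := by
  have h := intervalIntegral.norm_integral_le_of_norm_le_const (a := 0) (b := τ) (f := f) (C := C)
    fun u hu => hf u (by rw [uIoc_of_le hτ] at hu; exact hu.1.le)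
  rwa [sub_zero, abs_of_nonneg hτ] at h

/-- **O(N) gradient-norm bound for the SurF loss.** Suppose the
parameterized intensity `lam θ u` has parameter gradient bounded by `L` and is bounded
below by `lammin > 0` for `u ≥ 0`, and the compensator `Λ θ τ = ∫ u in 0..τ, lam θ u`
is differentiable in `θ` with gradient `∫ u in 0..τ, Dlam θ u`. Then the SurF loss
`𝓛 θ = ∑ i, Λ θ (τ i) + Λ θ ΔT - ∑ i, log (lam θ (τ i))` is differentiable with
`‖∇𝓛 θ‖ ≤ L (T + N / lammin)`; in particular, if `T = N / λ̄`, then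
`‖∇𝓛 θ‖ ≤ L N (1/λ̄ + 1/lammin)`. -/
theorem surf_loss_gradient_bound
    (p N : ℕ) (hp : 1 ≤ p) (hN : 1 ≤ N)
    (L lammin T ΔT : ℝ) (hlmin : 0 < lammin)
    (lam : EuclideanSpace ℝ (Fin p) → ℝ → ℝ)
    (Dlam : EuclideanSpace ℝ (Fin p) → ℝ → (EuclideanSpace ℝ (Fin p) →L[ℝ] ℝ))
    (hdiff : ∀ θ, ∀ u ≥ (0:ℝ), HasFDerivAt (fun θ' => lam θ' u) (Dlam θ u) θ)
    (hDbound : ∀ θ, ∀ u ≥ (0:ℝ), ‖Dlam θ u‖ ≤ L)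
    (hlb : ∀ θ, ∀ u ≥ (0:ℝ), lammin ≤ lam θ u)
    (Λ : EuclideanSpace ℝ (Fin p) → ℝ → ℝ)
    (hΛ : ∀ θ τ, Λ θ τ = ∫ u in (0:ℝ)..τ, lam θ u)
    (hΛdiff : ∀ θ, ∀ τ ≥ (0:ℝ),
      HasFDerivAt (fun θ' => Λ θ' τ) (∫ u in (0:ℝ)..τ, Dlam θ u) θ)
    (τs : Fin N → ℝ) (hτ : ∀ i, 0 ≤ τs i)
    (hΔT : 0 ≤ ΔT) (hT : (∑ i, τs i) + ΔT = T)
    (𝓛 : EuclideanSpace ℝ (Fin p) → ℝ)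
    (h𝓛 : ∀ θ, 𝓛 θ =
      (∑ i, Λ θ (τs i)) + Λ θ ΔT - ∑ i, Real.log (lam θ (τs i))) :
    Differentiable ℝ 𝓛 ∧
      (∀ θ, ‖fderiv ℝ 𝓛 θ‖ ≤ L * (T + N / lammin)) ∧
      (∀ lbar : ℝ, 0 < lbar → T = N / lbar →
        ∀ θ, ‖fderiv ℝ 𝓛 θ‖ ≤ L * N * (1 / lbar + 1 / lammin)) := by
  have hpos : ∀ θ, ∀ u ≥ (0:ℝ), 0 < lam θ u := fun θ u hu => hlmin.trans_le (hlb θ u hu)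
  have hderiv : ∀ θ, HasFDerivAt 𝓛
      ((∑ i, ∫ u in (0:ℝ)..τs i, Dlam θ u) + (∫ u in (0:ℝ)..ΔT, Dlam θ u)
        - ∑ i, (lam θ (τs i))⁻¹ • Dlam θ (τs i)) θ := by
    intro θ
    rw [funext h𝓛]
    exact ((HasFDerivAt.fun_sum fun i _ => hΛdiff θ _ (hτ i)).fun_add (hΛdiff θ _ hΔT)).fun_sub
      (HasFDerivAt.fun_sum fun i _ => (hdiff θ _ (hτ i)).log (hpos θ _ (hτ i)).ne')
  have hbound : ∀ θ, ‖fderiv ℝ 𝓛 θ‖ ≤ L * (T + N / lammin) := by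
    intro θ
    have hint : ∀ τ ≥ (0:ℝ), ‖∫ u in (0:ℝ)..τ, Dlam θ u‖ ≤ L * τ :=
      fun τ h0 => norm_intervalIntegral_le_mul h0 (hDbound θ)
    have hlog : ∀ i, ‖(lam θ (τs i))⁻¹ • Dlam θ (τs i)‖ ≤ lammin⁻¹ * L := by
      intro i
      rw [norm_smul, norm_inv, Real.norm_of_nonneg (hpos θ _ (hτ i)).le]
      exact mul_le_mul (inv_anti₀ hlmin (hlb θ _ (hτ i))) (hDbound θ _ (hτ i))
        (norm_nonneg _) (inv_nonneg.2 hlmin.le)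
    rw [(hderiv θ).fderiv]
    calc _ ≤ (∑ i, L * τs i) + L * ΔT + ∑ _i : Fin N, lammin⁻¹ * L :=
          (norm_sub_le _ _).trans <| add_le_add
            ((norm_add_le _ _).trans <| add_le_add
              (norm_sum_le_of_le _ fun i _ => hint _ (hτ i)) (hint _ hΔT))
            (norm_sum_le_of_le _ fun i _ => hlog i)
      _ = L * (T + N / lammin) := by
          rw [← hT, ← Finset.mul_sum, Finset.sum_const, Finset.card_univ, Fintype.card_fin,
            nsmul_eq_mul]
          ring
  refine ⟨fun θ => (hderiv θ).differentiableAt, hbound, fun lbar _ hTN θ => ?_⟩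
  refine (hbound θ).trans_eq ?_
  rw [hTN]
  ring
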